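/- Inverse radix splitting of the DFT: let r, m ≥ 1 and n = r·m. Then for every h ∈ ℂⁿ (0-based indices) and all 0 ≤ a < r, 0 ≤ b < m: (conj(F_n) · h)(a + r·b) = Σ_{j=0}^{m−1} conj(ω_n^{a·j}) · conj(ω_m^{j·b}) · ( Σ_{l=0}^{r−1} conj(ω_r^{a·l}) · h(j + m·l) ); equivalently, since F_n⁻¹ = (1/n) • conj(F_n), the inverse DFT (F_n⁻¹ · h)(a + r·b) equals (1/n) times the right-hand side. -/

import Mathlib

open Matrix Complex

/-- The primitive root `ω_n = exp(−2πi/n)`. -/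
noncomputable def ω (n : ℕ) : ℂ := Complex.exp (-(2 * Real.pi * Complex.I) / n)

/-- The `n × n` DFT matrix with 0-based entries `(F_n)_{jk} = ω_n^{j·k}`. -/
noncomputable def dftMatrix (n : ℕ) : Matrix (Fin n) (Fin n) ℂ :=
  fun j k => ω n ^ (j.val * k.val)

/-- The index `a + r·b` of `{0,…,r·m−1}`, for `a < r` and `b < m`. -/
def idxOut (r m : ℕ) (a : Fin r) (b : Fin m) : Fin (r * m) :=
  ⟨a.val + r * b.val, by
    have h1 : a.val + r * b.val < r * (b.val + 1) := by
      rw [Nat.mul_succ]; have := a.isLt; omega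
    have h2 : r * (b.val + 1) ≤ r * m :=
      Nat.mul_le_mul (Nat.le_refl r) (by have := b.isLt; omega)
    exact lt_of_lt_of_le h1 h2⟩

/-- The index `j + m·l` of `{0,…,r·m−1}`, for `j < m` and `l < r`. -/
def idxIn (r m : ℕ) (j : Fin m) (l : Fin r) : Fin (r * m) :=
  ⟨j.val + m * l.val, by
    have h1 : j.val + m * l.val < m * (l.val + 1) := by
      rw [Nat.mul_succ]; have := j.isLt; omega
    have h2 : m * (l.val + 1) ≤ m * r :=
      Nat.mul_le_mul (Nat.le_refl m) (by have := l.isLt; omega)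
    calc j.val + m * l.val < m * (l.val + 1) := h1
      _ ≤ m * r := h2
      _ = r * m := Nat.mul_comm m r⟩

/-- `ω_n` is a primitive `n`-th root of unity. -/
lemma isPrimitiveRoot_ω {n : ℕ} (hn : n ≠ 0) : IsPrimitiveRoot (ω n) n := by
  have h : ω n = (Complex.exp (2 * Real.pi * Complex.I / n))⁻¹ := by
    rw [ω, ← Complex.exp_neg, neg_div]
  rw [h]
  exact (Complex.isPrimitiveRoot_exp n hn).inv

lemma ω_mul_pow_left {r : ℕ} (hr : r ≠ 0) (m : ℕ) : ω (r * m) ^ r = ω m := by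
  have hr' : (r : ℂ) ≠ 0 := Nat.cast_ne_zero.mpr hr
  rw [ω, ω, ← Complex.exp_nat_mul, Nat.cast_mul, ← mul_div_assoc, mul_div_mul_left _ _ hr']

lemma ω_mul_pow_right (r : ℕ) {m : ℕ} (hm : m ≠ 0) : ω (r * m) ^ m = ω r := by
  rw [mul_comm, ω_mul_pow_left hm]

lemma conj_ω {n : ℕ} (hn : n ≠ 0) : (starRingEnd ℂ) (ω n) = (ω n)⁻¹ :=
  (Complex.inv_eq_conj ((isPrimitiveRoot_ω hn).norm'_eq_one hn)).symm

/-- Splitting of the twiddle factor at the output index `a + r·b` and the input index `j + m·l`. -/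
lemma ω_mul_pow_split {r m : ℕ} (hr : r ≠ 0) (hm : m ≠ 0) (a b j l : ℕ) :
    ω (r * m) ^ ((a + r * b) * (j + m * l)) =
      ω (r * m) ^ (a * j) * ω m ^ (j * b) * ω r ^ (a * l) := by
  have hexp : (a + r * b) * (j + m * l) =
      a * j + r * (j * b) + m * (a * l) + (r * m) * (b * l) := by ring
  rw [hexp, pow_add, pow_add, pow_add, pow_mul _ r, pow_mul _ m, pow_mul _ (r * m),
    ω_mul_pow_left hr, ω_mul_pow_right r hm,
    (isPrimitiveRoot_ω (mul_ne_zero hr hm)).pow_eq_one, one_pow, mul_one]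

/-- Summation over `{0,…,r·m−1}` along the input indices `j + m·l`. -/
lemma sum_idxIn {M : Type*} [AddCommMonoid M] (r m : ℕ) (f : Fin (r * m) → M) :
    ∑ k, f k = ∑ j : Fin m, ∑ l : Fin r, f (idxIn r m j l) := by
  rw [← finProdFinEquiv.sum_comp, Fintype.sum_prod_type_right]
  rfl

lemma dftMatrix_mul_conj {n : ℕ} (hn : n ≠ 0) :
    dftMatrix n * (dftMatrix n).map (starRingEnd ℂ) = (n : ℂ) • 1 := by
  have hω := isPrimitiveRoot_ω hn
  have h0 : ω n ≠ 0 := hω.ne_zero hn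
  ext i j
  set z : ℂ := ω n ^ i.val * (ω n ^ j.val)⁻¹ with hz
  have hsum : (dftMatrix n * (dftMatrix n).map (starRingEnd ℂ)) i j =
      ∑ k ∈ Finset.range n, z ^ k := by
    rw [Matrix.mul_apply, ← Fin.sum_univ_eq_sum_range (fun k => z ^ k)]
    refine Finset.sum_congr rfl fun k _ => ?_
    rw [Matrix.map_apply, dftMatrix, dftMatrix, map_pow, conj_ω hn, hz, mul_pow, ← inv_pow,
      ← pow_mul, ← pow_mul, mul_comm k.val]
  rw [hsum, Matrix.smul_apply, smul_eq_mul]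
  rcases eq_or_ne i j with rfl | hij
  · have h1 : z = 1 := mul_inv_cancel₀ (pow_ne_zero _ h0)
    simp [h1]
  · have h1 : z ≠ 1 := fun h =>
      hij (Fin.ext (hω.pow_inj i.isLt j.isLt (eq_of_div_eq_one (by rwa [div_eq_mul_inv]))))
    have hzn : z ^ n = 1 := by
      rw [hz, mul_pow, inv_pow, pow_right_comm, hω.pow_eq_one, pow_right_comm, hω.pow_eq_one]
      simp
    rw [geom_sum_eq h1, hzn, Matrix.one_apply_ne hij]
    simp

/-- The inverse DFT matrix is `(1/n) • conj(F_n)`. -/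
lemma dftMatrix_inv {n : ℕ} (hn : n ≠ 0) :
    (dftMatrix n)⁻¹ = ((1 : ℂ) / n) • (dftMatrix n).map (starRingEnd ℂ) := by
  refine Matrix.inv_eq_right_inv ?_
  rw [Matrix.mul_smul, dftMatrix_mul_conj hn, smul_smul,
    one_div_mul_cancel (Nat.cast_ne_zero.mpr hn), one_smul]

/-- Radix splitting of multiplication by `conj(F_n)`, for `n = r·m`. -/
lemma conj_dftMatrix_mulVec_idxOut {r m : ℕ} (hr : r ≠ 0) (hm : m ≠ 0)
    (h : Fin (r * m) → ℂ) (a : Fin r) (b : Fin m) :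
    ((dftMatrix (r * m)).map (starRingEnd ℂ)).mulVec h (idxOut r m a b)
      = ∑ j : Fin m, (starRingEnd ℂ) (ω (r * m) ^ (a.val * j.val)) *
          (starRingEnd ℂ) (ω m ^ (j.val * b.val)) *
          ∑ l : Fin r, (starRingEnd ℂ) (ω r ^ (a.val * l.val)) * h (idxIn r m j l) := by
  rw [Matrix.mulVec, dotProduct, sum_idxIn]
  refine Finset.sum_congr rfl fun j _ => ?_
  rw [Finset.mul_sum]
  refine Finset.sum_congr rfl fun l _ => ?_
  rw [Matrix.map_apply, dftMatrix, idxOut, idxIn, ω_mul_pow_split hr hm, map_mul, map_mul, mul_assoc]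

/-- Inverse radix splitting of the DFT: for `n = r·m`, `a < r` and `b < m`,
`(conj(F_n)·h)(a + r·b)
  = Σ_{j<m} conj(ω_n^{a·j}) conj(ω_m^{j·b}) (Σ_{l<r} conj(ω_r^{a·l}) h(j + m·l))`;
equivalently, since `F_n⁻¹ = (1/n) • conj(F_n)`, the inverse DFT `(F_n⁻¹·h)(a + r·b)`
equals `(1/n)` times the right-hand side. -/
theorem stmt11 (r m : ℕ) (hr : 1 ≤ r) (hm : 1 ≤ m)
    (h : Fin (r * m) → ℂ) (a : Fin r) (b : Fin m) :
    ((dftMatrix (r * m)).map (starRingEnd ℂ)).mulVec h (idxOut r m a b)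
      = ∑ j : Fin m, (starRingEnd ℂ) (ω (r * m) ^ (a.val * j.val)) *
          (starRingEnd ℂ) (ω m ^ (j.val * b.val)) *
          ∑ l : Fin r, (starRingEnd ℂ) (ω r ^ (a.val * l.val)) * h (idxIn r m j l) ∧
    (dftMatrix (r * m))⁻¹.mulVec h (idxOut r m a b)
      = ((1 : ℂ) / ((r : ℂ) * (m : ℂ))) *
          ∑ j : Fin m, (starRingEnd ℂ) (ω (r * m) ^ (a.val * j.val)) *
            (starRingEnd ℂ) (ω m ^ (j.val * b.val)) *
            ∑ l : Fin r, (starRingEnd ℂ) (ω r ^ (a.val * l.val)) * h (idxIn r m j l) := by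
  have hr' : r ≠ 0 := Nat.ne_of_gt hr
  have hm' : m ≠ 0 := Nat.ne_of_gt hm
  have hconj := conj_dftMatrix_mulVec_idxOut hr' hm' h a b
  refine ⟨hconj, ?_⟩
  rw [dftMatrix_inv (mul_ne_zero hr' hm'), Matrix.smul_mulVec, Pi.smul_apply, hconj, smul_eq_mul,
    Nat.cast_mul]
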